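/- arXiv:1706.08185 — 6 statements merged into one kernel-verified Lean document; each statement's English description precedes it below -/
import Mathlib

section
/- For all real μ0, ν0: the matrix J0(μ0,ν0) has 0 as an eigenvalue if and only if μ0 = (9/16)ν0²; moreover, on the curve μ0 = −ν0² the characteristic polynomial of J0(−ν0², ν0) equals (X² + (5/4)ν0)², so all eigenvalues are double. -/
open Polynomial Matrix

noncomputable section

/-- The matrix of the linear Hamiltonian vector field of the deformed standard normal form
H0 = (1/2)p2² − p1 q2 + (μ0/2)q1² + ν0((1/2)q2² + (3/4)p2 q1). -/
def J0 (μ0 ν0 : ℝ) : Matrix (Fin 4) (Fin 4) ℝ :=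
  !![0, -1, 0, 0;
     (3/4)*ν0, 0, 0, 1;
     -μ0, 0, 0, -(3/4)*ν0;
     0, -ν0, 1, 0]

theorem J0_charpoly (μ0 ν0 : ℝ) : (J0 μ0 ν0).charpoly
    = X^4 + C ((5/2)*ν0) * X^2 + C ((9/16)*ν0^2 - μ0) := by
  have e : (J0 μ0 ν0).charmatrix = !![X, 1, 0, 0;
     -C ((3/4)*ν0), X, 0, -1;
     C μ0, 0, X, C ((3/4)*ν0);
     0, C ν0, -1, X] := by
    ext1 i j
    fin_cases i <;> fin_cases j <;> simp [J0, Matrix.charmatrix_apply]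
  rw [Matrix.charpoly, e]
  have h1 : (C ((5/2)*ν0) : ℝ[X]) = 2 * C ((3/4)*ν0) + C ν0 := by
    rw [← C_ofNat, ← C_mul, ← C_add]; congr 1; ring
  have h2 : (C ((9/16)*ν0^2 - μ0) : ℝ[X]) = C ((3/4)*ν0)^2 - C μ0 := by
    rw [← C_pow, ← C_sub]; congr 1; ring
  rw [h1, h2]
  generalize (C ((3/4)*ν0) : ℝ[X]) = a
  simp [Matrix.det_succ_row_zero, Fin.sum_univ_succ, Fin.succAbove]
  ring

theorem stmt_3 :
    (∀ μ0 ν0 : ℝ,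
      Module.End.HasEigenvalue (Matrix.toLin' (J0 μ0 ν0)) 0 ↔ μ0 = (9/16)*ν0^2) ∧
    (∀ ν0 : ℝ, (J0 (-ν0^2) ν0).charpoly = (X^2 + C ((5/4)*ν0))^2) := by
  refine ⟨fun μ0 ν0 => ?_, fun ν0 => ?_⟩
  · rw [Module.End.hasEigenvalue_iff_isRoot_charpoly, Matrix.charpoly_toLin', J0_charpoly]
    simp only [IsRoot.def, eval_add, eval_mul, eval_pow, eval_X, eval_C]
    constructor <;> intro h <;> linarith
  · rw [J0_charpoly]
    have h1 : (C ((5/2)*ν0) : ℝ[X]) = 2 * C ((5/4)*ν0) := by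
      rw [← C_ofNat, ← C_mul]; congr 1; ring
    have h2 : (C ((9/16)*ν0^2 - -ν0^2) : ℝ[X]) = C ((5/4)*ν0)^2 := by
      rw [← C_pow]; congr 1; ring
    rw [h1, h2]; ring
end
end

section
/- For all real μ1, ν1, the characteristic polynomial of the matrix J1(μ1,ν1) equals X⁴ − 2μ1 X² + (μ1² − ν1), and it coincides with the characteristic polynomial of J0(φ(μ1,ν1)) where φ(μ1,ν1) = (ν1 − (16/25)μ1², −(4/5)μ1). In particular J1(μ1,ν1) and J0(φ(μ1,ν1)) have the same eigenvalues. -/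
open Polynomial Matrix

noncomputable section

/-- The matrix of the linear Hamiltonian vector field of
H1 = (1/2)p2² − p1 q2 + (ν1/2)q1² − μ1 p2 q1. -/
def J1 (μ1 ν1 : ℝ) : Matrix (Fin 4) (Fin 4) ℝ :=
  !![0, -1, 0, 0;
     -μ1, 0, 0, 1;
     -ν1, 0, 0, μ1;
     0, 0, 1, 0]

theorem J1_eval (a b x : ℝ) : (J1 a b).charpoly.eval x = x^4 - 2*a*x^2 + (a^2 - b) := by
  rw [Matrix.eval_charpoly]
  simp [J1, Matrix.det_succ_row_zero, Fin.sum_univ_succ, Fin.succAbove, Matrix.scalar_apply,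
    Matrix.diagonal_apply]
  ring

theorem J0_eval (a b x : ℝ) :
    (J0 a b).charpoly.eval x = x^4 + 5/2*b*x^2 + (9/16*b^2 - a) := by
  rw [Matrix.eval_charpoly]
  simp [J0, Matrix.det_succ_row_zero, Fin.sum_univ_succ, Fin.succAbove, Matrix.scalar_apply,
    Matrix.diagonal_apply]
  ring

theorem stmt_5 (μ1 ν1 : ℝ) :
    (J1 μ1 ν1).charpoly = X^4 - C (2*μ1) * X^2 + C (μ1^2 - ν1) ∧
    (J1 μ1 ν1).charpoly = (J0 (ν1 - (16/25)*μ1^2) (-(4/5)*μ1)).charpoly := by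
  constructor
  · apply Polynomial.funext
    intro x
    rw [J1_eval]
    simp
  · apply Polynomial.funext
    intro x
    rw [J1_eval, J0_eval]
    ring
end
end

section
/- Fix real constants a1, a2, a3 and parameters κ, μ, ν. A point x = (q1,q2,p1,p2) ∈ ℝ⁴ satisfies F_{κ,μ,ν}(x) = 0 if and only if there exists q0 ∈ ℝ such that x = x*(q0) := (q0, (3/2)a3 q0², (3/8)(a3 ν q0² + a2 a3 q0³ + 3 a3³ q0⁴), −(3/4)(ν q0 + a2 q0² + 3 a3² q0³)) and q0 satisfies the quintic equation (27/16)a3⁴ q0⁵ + (45/16)a2 a3² q0⁴ + (9/4)a3² ν q0³ + (9/8)a2² q0³ + (27/16)a2 ν q0² − (1/2)a1 q0² + (9/16)ν² q0 − μ q0 − κ = 0. -/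
noncomputable section

/-- The vector field of the order-3 truncated normal form Hamiltonian near a degree-4
nilpotent equilibrium, in coordinates (q1,q2,p1,p2) = (v 0, v 1, v 2, v 3). -/
def Fvf (a1 a2 a3 κ μ ν : ℝ) (v : Fin 4 → ℝ) : Fin 4 → ℝ :=
  ![ (3*a3/2)*(v 0)^2 - v 1,
     v 3 + (3*ν/4)*(v 0) + (3*a2/4)*(v 0)^2 + (3*a3/2)*(v 0)*(v 1),
     -κ - (3*ν/4)*(v 3) - μ*(v 0) - 3*a3*(v 2)*(v 0) - (3*a2/2)*(v 3)*(v 0)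
       - (a1/2)*(v 0)^2 - (3*a3/2)*(v 3)*(v 1) - (a2/2)*(v 1)^2,
     v 2 - (3*a3/2)*(v 3)*(v 0) - ν*(v 1) - a2*(v 0)*(v 1) - 2*a3*(v 1)^2 ]

/-- The candidate equilibrium point x*(q0). -/
def xstar (a2 a3 ν q0 : ℝ) : Fin 4 → ℝ :=
  ![ q0,
     (3/2)*a3*q0^2,
     (3/8)*(a3*ν*q0^2 + a2*a3*q0^3 + 3*a3^3*q0^4),
     -(3/4)*(ν*q0 + a2*q0^2 + 3*a3^2*q0^3) ]

theorem stmt_6 (a1 a2 a3 κ μ ν : ℝ) (x : Fin 4 → ℝ) :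
    Fvf a1 a2 a3 κ μ ν x = 0 ↔
    ∃ q0 : ℝ, x = xstar a2 a3 ν q0 ∧
      (27/16)*a3^4*q0^5 + (45/16)*a2*a3^2*q0^4 + (9/4)*a3^2*ν*q0^3 + (9/8)*a2^2*q0^3
        + (27/16)*a2*ν*q0^2 - (1/2)*a1*q0^2 + (9/16)*ν^2*q0 - μ*q0 - κ = 0 := by
  have key : Fvf a1 a2 a3 κ μ ν x = 0 ↔
      ((3*a3/2)*(x 0)^2 - x 1 = 0 ∧
      x 3 + (3*ν/4)*(x 0) + (3*a2/4)*(x 0)^2 + (3*a3/2)*(x 0)*(x 1) = 0 ∧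
      -κ - (3*ν/4)*(x 3) - μ*(x 0) - 3*a3*(x 2)*(x 0) - (3*a2/2)*(x 3)*(x 0)
       - (a1/2)*(x 0)^2 - (3*a3/2)*(x 3)*(x 1) - (a2/2)*(x 1)^2 = 0 ∧
      x 2 - (3*a3/2)*(x 3)*(x 0) - ν*(x 1) - a2*(x 0)*(x 1) - 2*a3*(x 1)^2 = 0) := by
    constructor
    · intro h
      exact ⟨congrFun h 0, congrFun h 1, congrFun h 2, congrFun h 3⟩
    · rintro ⟨h0, h1, h2, h3⟩
      funext i
      fin_cases i
      · exact h0
      · exact h1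
      · exact h2
      · exact h3
  rw [key]
  constructor
  · rintro ⟨h0, h1, h2, h3⟩
    have e1 : x 1 = (3/2)*a3*(x 0)^2 := by linear_combination -h0
    rw [e1] at h1 h2 h3
    have e3 : x 3 = -(3/4)*(ν*x 0 + a2*(x 0)^2 + 3*a3^2*(x 0)^3) := by
      linear_combination h1
    rw [e3] at h2 h3
    have e2 : x 2 = (3/8)*(a3*ν*(x 0)^2 + a2*a3*(x 0)^3 + 3*a3^3*(x 0)^4) := by
      linear_combination h3
    rw [e2] at h2
    refine ⟨x 0, ?_, by linear_combination h2⟩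
    funext i
    fin_cases i
    · rfl
    · exact e1
    · exact e2
    · exact e3
  · rintro ⟨q, hx, hq⟩
    have e0 : x 0 = q := congrFun hx 0
    have e1 : x 1 = (3/2)*a3*q^2 := congrFun hx 1
    have e2 : x 2 = (3/8)*(a3*ν*q^2 + a2*a3*q^3 + 3*a3^3*q^4) := congrFun hx 2
    have e3 : x 3 = -(3/4)*(ν*q + a2*q^2 + 3*a3^2*q^3) := congrFun hx 3
    rw [e0, e1, e2, e3]
    refine ⟨by ring, by ring, by linear_combination hq, by ring⟩
end
end

section
/- Fix real constants a1, a2, a3 and parameters κ, μ, ν, and let q0 ∈ ℝ. The characteristic polynomial of the Jacobian matrix of F_{κ,μ,ν} at the point x*(q0) = (q0, (3/2)a3 q0², (3/8)(a3 ν q0² + a2 a3 q0³ + 3 a3³ q0⁴), −(3/4)(ν q0 + a2 q0² + 3 a3² q0³)) equals X⁴ − (Q/4) X² + (Q² − P)/64, where Q = Q(ν,q0) := 3a3² q0² − 16 a2 q0 − 10ν and P = P(μ,ν,q0) := −531 a3⁴ q0⁴ − 816 a2 a3² q0³ − 492 a3² ν q0² + 40 a2² q0² + 104 a2 ν q0 +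 64 ν² + 64 a1 q0 + 64 μ. In particular the eigenvalues λ satisfy λ² = (Q ± √P)/8 when P ≥ 0. -/
open Polynomial Matrix

noncomputable section

/-- The Jacobian matrix of a vector field F : ℝ⁴ → ℝ⁴ at a point x:
the 4×4 matrix of partial derivatives of the components of F at x. -/
def jacobian (F : (Fin 4 → ℝ) → (Fin 4 → ℝ)) (x : Fin 4 → ℝ) :
    Matrix (Fin 4) (Fin 4) ℝ :=
  Matrix.of fun i j => fderiv ℝ (fun y => F y i) x (Pi.single j 1)

theorem jac_aux (a1 a2 a3 κ μ ν : ℝ) (x : Fin 4 → ℝ) :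
    jacobian (Fvf a1 a2 a3 κ μ ν) x =
    !![3*a3*x 0, -1, 0, 0;
       3*ν/4 + 3*a2/2*x 0 + 3*a3/2*x 1, 3*a3/2*x 0, 0, 1;
       -μ - 3*a3*x 2 - 3*a2/2*x 3 - a1*x 0, -(3*a3/2)*x 3 - a2*x 1, -3*a3*x 0,
         -(3*ν/4) - 3*a2/2*x 0 - 3*a3/2*x 1;
       -(3*a3/2)*x 3 - a2*x 1, -ν - a2*x 0 - 4*a3*x 1, 1, -(3*a3/2)*x 0] := by
  have h : ∀ i : Fin 4, HasFDerivAt (fun y : Fin 4 → ℝ => y i)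
      (ContinuousLinearMap.proj (R := ℝ) (φ := fun _ : Fin 4 => ℝ) i) x :=
    fun i => hasFDerivAt_apply i x
  have h0 : HasFDerivAt (fun y => Fvf a1 a2 a3 κ μ ν y 0) _ x :=
    (((h 0).pow 2).const_mul (3*a3/2)).sub (h 1)
  have h1 : HasFDerivAt (fun y => Fvf a1 a2 a3 κ μ ν y 1) _ x :=
    (((h 3).add ((h 0).const_mul (3*ν/4))).add (((h 0).pow 2).const_mul (3*a2/4))).add
      (((h 0).const_mul (3*a3/2)).mul (h 1))
  have h2 : HasFDerivAt (fun y => Fvf a1 a2 a3 κ μ ν y 2) _ x :=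
    ((((((((hasFDerivAt_const (-κ) x).sub ((h 3).const_mul (3*ν/4))).sub ((h 0).const_mul μ)).sub
      (((h 2).const_mul (3*a3)).mul (h 0))).sub (((h 3).const_mul (3*a2/2)).mul (h 0))).sub
      (((h 0).pow 2).const_mul (a1/2))).sub (((h 3).const_mul (3*a3/2)).mul (h 1))).sub
      (((h 1).pow 2).const_mul (a2/2)))
  have h3 : HasFDerivAt (fun y => Fvf a1 a2 a3 κ μ ν y 3) _ x :=
    ((((h 2).sub (((h 3).const_mul (3*a3/2)).mul (h 0))).sub ((h 1).const_mul ν)).sub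
      (((h 0).const_mul a2).mul (h 1))).sub (((h 1).pow 2).const_mul (2*a3))
  ext i j
  fin_cases i
  · change fderiv ℝ (fun y => Fvf a1 a2 a3 κ μ ν y 0) x (Pi.single j 1) = _
    rw [h0.fderiv]
    fin_cases j <;> simp [Pi.single_apply] <;> ring
  · change fderiv ℝ (fun y => Fvf a1 a2 a3 κ μ ν y 1) x (Pi.single j 1) = _
    rw [h1.fderiv]
    fin_cases j <;> simp [Pi.single_apply] <;> ring
  · change fderiv ℝ (fun y => Fvf a1 a2 a3 κ μ ν y 2) x (Pi.single j 1) = _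
    rw [h2.fderiv]
    fin_cases j <;> simp [Pi.single_apply] <;> ring
  · change fderiv ℝ (fun y => Fvf a1 a2 a3 κ μ ν y 3) x (Pi.single j 1) = _
    rw [h3.fderiv]
    fin_cases j <;> simp [Pi.single_apply] <;> ring

theorem stmt_7 (a1 a2 a3 κ μ ν q0 : ℝ)
    (Q P : ℝ)
    (hQ : Q = 3*a3^2*q0^2 - 16*a2*q0 - 10*ν)
    (hP : P = -531*a3^4*q0^4 - 816*a2*a3^2*q0^3 - 492*a3^2*ν*q0^2 + 40*a2^2*q0^2
      + 104*a2*ν*q0 + 64*ν^2 + 64*a1*q0 + 64*μ) :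
    (jacobian (Fvf a1 a2 a3 κ μ ν) (xstar a2 a3 ν q0)).charpoly =
      X^4 - C (Q/4) * X^2 + C ((Q^2 - P)/64) ∧
    ∀ lam : ℂ,
      (((jacobian (Fvf a1 a2 a3 κ μ ν) (xstar a2 a3 ν q0)).map
          (fun r => (r : ℂ))).charpoly).IsRoot lam →
      0 ≤ P →
      lam^2 = ((Q : ℂ) + (Real.sqrt P : ℝ))/8 ∨
      lam^2 = ((Q : ℂ) - (Real.sqrt P : ℝ))/8 := by
  have key : (jacobian (Fvf a1 a2 a3 κ μ ν) (xstar a2 a3 ν q0)).charpoly =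
      X^4 - C (Q/4) * X^2 + C ((Q^2 - P)/64) := by
    apply Polynomial.funext
    intro r
    rw [Matrix.eval_charpoly, jac_aux, hQ, hP]
    simp [Matrix.det_succ_row_zero, Fin.sum_univ_succ, xstar, Fin.succAbove]
    ring
  refine ⟨key, ?_⟩
  intro lam hl hP0
  have hm : ((jacobian (Fvf a1 a2 a3 κ μ ν) (xstar a2 a3 ν q0)).map
      (fun r => (r : ℂ))).charpoly = (X^4 - C (Q/4) * X^2 + C ((Q^2 - P)/64)).map Complex.ofRealHom := by
    rw [← key]
    exact Matrix.charpoly_map _ Complex.ofRealHom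
  rw [hm] at hl
  have hs : ((Real.sqrt P : ℝ) : ℂ)^2 = (P : ℂ) := by
    rw [← Complex.ofReal_pow, Real.sq_sqrt hP0]
  simp [Polynomial.IsRoot] at hl
  have : (lam^2 - ((Q : ℂ) + (Real.sqrt P : ℝ))/8) * (lam^2 - ((Q : ℂ) - (Real.sqrt P : ℝ))/8) = 0 := by
    linear_combination hl - hs / 64
  rcases mul_eq_zero.mp this with h | h
  · left; exact sub_eq_zero.mp h
  · right; exact sub_eq_zero.mp h
end
end

section
/- Fix real constants a1, a2, a3, a parameter ν, and q0 ∈ ℝ, and set μ = μ_f(ν,q0) := (9/16)ν² − a1 q0 + (27/8)a2 ν q0 + (27/8)a2² q0² + (27/4)a3² ν q0² + (45/4)a2 a3² q0³ + (135/16)a3⁴ q0⁴. Then for any κ, the characteristic polynomial of the Jacobian matrix of F_{κ,μ,ν} at x*(q0) equals X² (X² − Q/4), where Q = 3a3² q0² − 16 a2 q0 − 10ν. In particular 0 is an eigenvalue of algebraic multiplicity at least two, and the remaining eigenvalues are ±√(Q/4). -/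
open Polynomial Matrix

noncomputable section

/-- The fold surface μ = μ_f(ν,q0). -/
def muF (a1 a2 a3 ν q0 : ℝ) : ℝ :=
  (9/16)*ν^2 - a1*q0 + (27/8)*a2*ν*q0 + (27/8)*a2^2*q0^2 + (27/4)*a3^2*ν*q0^2
    + (45/4)*a2*a3^2*q0^3 + (135/16)*a3^4*q0^4

lemma jac_eq (a1 a2 a3 κ μ ν : ℝ) (x : Fin 4 → ℝ) :
    jacobian (Fvf a1 a2 a3 κ μ ν) x =
    !![3*a3*x 0, -1, 0, 0;
       3*ν/4+3*a2/2*x 0+3*a3/2*x 1, 3*a3/2*x 0, 0, 1;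
       -μ-3*a3*x 2-3*a2/2*x 3-a1*x 0, -(3*a3/2*x 3)-a2*x 1, -(3*a3*x 0),
         -(3*ν/4)-3*a2/2*x 0-3*a3/2*x 1;
       -(3*a3/2*x 3)-a2*x 1, -ν-a2*x 0-4*a3*x 1, 1, -(3*a3/2*x 0)] := by
  have h (k : Fin 4) : HasFDerivAt (fun y : Fin 4 → ℝ => y k)
      (ContinuousLinearMap.proj (R := ℝ) (φ := fun _ : Fin 4 => ℝ) k) x :=
    hasFDerivAt_apply k x
  have e0 := ((h 0).pow 2 |>.const_mul (3*a3/2)).sub (h 1)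
  have e1 := (((h 3).add ((h 0).const_mul (3*ν/4))).add
    ((h 0).pow 2 |>.const_mul (3*a2/4))).add (((h 0).const_mul (3*a3/2)).mul (h 1))
  have e2 := (((((((hasFDerivAt_const (-κ) x).sub ((h 3).const_mul (3*ν/4))).sub
    ((h 0).const_mul μ)).sub (((h 2).const_mul (3*a3)).mul (h 0))).sub
    (((h 3).const_mul (3*a2/2)).mul (h 0))).sub ((h 0).pow 2 |>.const_mul (a1/2))).sub
    (((h 3).const_mul (3*a3/2)).mul (h 1))).sub ((h 1).pow 2 |>.const_mul (a2/2))
  have e3 := ((((h 2).sub (((h 3).const_mul (3*a3/2)).mul (h 0))).sub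
    ((h 1).const_mul ν)).sub (((h 0).const_mul a2).mul (h 1))).sub
    ((h 1).pow 2 |>.const_mul (2*a3))
  have f0 : fderiv ℝ (fun y => Fvf a1 a2 a3 κ μ ν y 0) x = _ := e0.fderiv
  have f1 : fderiv ℝ (fun y => Fvf a1 a2 a3 κ μ ν y 1) x = _ := e1.fderiv
  have f2 : fderiv ℝ (fun y => Fvf a1 a2 a3 κ μ ν y 2) x = _ := e2.fderiv
  have f3 : fderiv ℝ (fun y => Fvf a1 a2 a3 κ μ ν y 3) x = _ := e3.fderiv
  ext i j
  fin_cases i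
  · change fderiv ℝ (fun y => Fvf a1 a2 a3 κ μ ν y 0) x _ = _
    rw [f0]
    fin_cases j <;> simp [Pi.single_apply] <;> ring
  · change fderiv ℝ (fun y => Fvf a1 a2 a3 κ μ ν y 1) x _ = _
    rw [f1]
    fin_cases j <;> simp [Pi.single_apply] <;> ring
  · change fderiv ℝ (fun y => Fvf a1 a2 a3 κ μ ν y 2) x _ = _
    rw [f2]
    fin_cases j <;> simp [Pi.single_apply] <;> ring
  · change fderiv ℝ (fun y => Fvf a1 a2 a3 κ μ ν y 3) x _ = _
    rw [f3]
    fin_cases j <;> simp [Pi.single_apply] <;> ring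

lemma det4_sub (t a b c d e f g h i j k l m n o p : ℝ) :
    (Matrix.scalar (Fin 4) t - !![a,b,c,d;e,f,g,h;i,j,k,l;m,n,o,p]).det =
    (t-a)*((t-f)*((t-k)*(t-p)-l*o) - g*(j*(t-p)+l*n) - h*(j*o+(t-k)*n))
    - b*(e*((t-k)*(t-p)-l*o) + g*(i*(t-p)+l*m) + h*(i*o+(t-k)*m))
    - c*(e*(j*(t-p)+l*n) + (t-f)*(i*(t-p)+l*m) - h*(i*n-j*m))
    - d*(e*(j*o+(t-k)*n) + (t-f)*(i*o+(t-k)*m) + g*(i*n-j*m)) := by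
  have : Matrix.scalar (Fin 4) t - !![a,b,c,d;e,f,g,h;i,j,k,l;m,n,o,p] =
      !![t-a,-b,-c,-d;-e,t-f,-g,-h;-i,-j,t-k,-l;-m,-n,-o,t-p] := by
    ext x y
    fin_cases x <;> fin_cases y <;> simp
  rw [this, Matrix.det_succ_row_zero]
  simp [Fin.sum_univ_succ, Matrix.det_fin_three, Fin.succAbove]
  ring

theorem stmt_11 (a1 a2 a3 ν q0 κ : ℝ)
    (Q : ℝ) (hQ : Q = 3*a3^2*q0^2 - 16*a2*q0 - 10*ν) :
    (jacobian (Fvf a1 a2 a3 κ (muF a1 a2 a3 ν q0) ν) (xstar a2 a3 ν q0)).charpoly =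
      X^2 * (X^2 - C (Q/4)) := by
  rw [jac_eq]
  apply Polynomial.funext
  intro t
  rw [Matrix.eval_charpoly, det4_sub]
  subst hQ
  have h0 : xstar a2 a3 ν q0 0 = q0 := rfl
  have h1 : xstar a2 a3 ν q0 1 = (3/2)*a3*q0^2 := rfl
  have h2 : xstar a2 a3 ν q0 2 = (3/8)*(a3*ν*q0^2 + a2*a3*q0^3 + 3*a3^3*q0^4) := rfl
  have h3 : xstar a2 a3 ν q0 3 = -(3/4)*(ν*q0 + a2*q0^2 + 3*a3^2*q0^3) := rfl
  rw [h0, h1, h2, h3, muF]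
  simp only [eval_mul, eval_sub, eval_pow, eval_X, eval_C]
  ring
end
end

section
/- Fix real constants a1, a2, a3 with a1 ≠ 0, and define the polynomial F(q0, ω) := (320/3)a1² − 288 a1 a2² q0 + (972/5)a2⁴ q0² − 2808 a1 a2 a3² q0² + (18954/5)a2³ a3² q0³ − 8064 a1 a3⁴ q0³ + (587331/20)a2² a3⁴ q0⁴ + (530712/5)a2 a3⁶ q0⁵ + (762048/5)a3⁸ q0⁶ + (16/3)a1 a2 ω² − (36/5)a2³ q0 ω² − 344 a1 a3² q0 ω² + (11907/50)a2² a3² q0² ω² + (180513/50)a2 a3⁴ q0³ ω² + (609093/50)a3⁶ q0⁴ ω² − (36/5)a2² ω⁴ − (682/25)a2 a3² q0 ω⁴ + (25959/100)a3⁴ q0² ω⁴ + (1328/75)a3² ω⁶. Then F(0,0) = (320/3)a1² > 0, and there exists δ > 0 such that F(q0, ω) > 0 whenever |q0| < δ and |ω| < δ. Consequently the coefficient C_m of M² in the Hamiltonian-Hopf normal form, which satisfies ω⁸ C_m = F(q0,ω), is positive near the origin, so the Hamiltonian-Hopf bifurcation in the unfolding of the nilpotent equilibrium is always of the supercritical type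 when a1 ≠ 0. -/
noncomputable section

/-- The polynomial F(q0,ω) such that ω⁸ C_m = F(q0,ω), where C_m is the coefficient
of M² in the Hamiltonian-Hopf normal form on the Hopf surface. -/
def Fcm (a1 a2 a3 q0 ω : ℝ) : ℝ :=
  (320/3)*a1^2 - 288*a1*a2^2*q0 + (972/5)*a2^4*q0^2 - 2808*a1*a2*a3^2*q0^2
    + (18954/5)*a2^3*a3^2*q0^3 - 8064*a1*a3^4*q0^3 + (587331/20)*a2^2*a3^4*q0^4
    + (530712/5)*a2*a3^6*q0^5 + (762048/5)*a3^8*q0^6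
    + (16/3)*a1*a2*ω^2 - (36/5)*a2^3*q0*ω^2 - 344*a1*a3^2*q0*ω^2
    + (11907/50)*a2^2*a3^2*q0^2*ω^2 + (180513/50)*a2*a3^4*q0^3*ω^2
    + (609093/50)*a3^6*q0^4*ω^2 - (36/5)*a2^2*ω^4 - (682/25)*a2*a3^2*q0*ω^4
    + (25959/100)*a3^4*q0^2*ω^4 + (1328/75)*a3^2*ω^6

theorem Fcm_cont_aux (a1 a2 a3 : ℝ) :
    Continuous (fun p : ℝ × ℝ => Fcm a1 a2 a3 p.1 p.2) := by
  unfold Fcm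
  fun_prop

theorem Fcm_zero_aux (a1 a2 a3 : ℝ) : Fcm a1 a2 a3 0 0 = (320/3)*a1^2 := by
  unfold Fcm
  ring

theorem Fcm_nhds_aux (f : ℝ × ℝ → ℝ) (hc : Continuous f) (h : 0 < f (0, 0)) :
    ∃ δ > 0, ∀ q0 ω : ℝ, |q0| < δ → |ω| < δ → f (q0, ω) > 0 := by
  have hopen : IsOpen {p : ℝ × ℝ | 0 < f p} := isOpen_lt continuous_const hc
  obtain ⟨δ, hδ, hball⟩ := Metric.isOpen_iff.mp hopen ((0 : ℝ), (0 : ℝ)) h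
  refine ⟨δ, hδ, fun q0 ω hq hω => ?_⟩
  have hm : (q0, ω) ∈ Metric.ball ((0 : ℝ), (0 : ℝ)) δ := by
    rw [Metric.mem_ball, Prod.dist_eq]
    simp only [Real.dist_eq, sub_zero]
    exact max_lt hq hω
  exact hball hm

theorem stmt_19 (a1 a2 a3 : ℝ) (ha1 : a1 ≠ 0) :
    Fcm a1 a2 a3 0 0 = (320/3)*a1^2 ∧
    (320/3)*a1^2 > 0 ∧
    ∃ δ > 0, ∀ q0 ω : ℝ, |q0| < δ → |ω| < δ → Fcm a1 a2 a3 q0 ω > 0 := by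
  have hpos : (320/3)*a1^2 > 0 := by positivity
  refine ⟨Fcm_zero_aux a1 a2 a3, hpos, ?_⟩
  exact Fcm_nhds_aux (fun p => Fcm a1 a2 a3 p.1 p.2) (Fcm_cont_aux a1 a2 a3)
    (lt_of_lt_of_eq hpos (Fcm_zero_aux a1 a2 a3).symm)
end
end
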